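/- arXiv:1511.00139 — 2 statements merged into one kernel-verified Lean document; each statement's English description precedes it below -/
import Mathlib

section
/- The protein folding map G is topologically transitive on (X, d): for every pair of nonempty open sets U, V ⊆ X there exists an integer k ≥ 1 such that G^k(U) ∩ V ≠ ∅. -/
open scoped BigOperators

/-- Absolute-encoding conformations of a protein with `N+1` residues:
maps `{1,…,N} → {1,2,3,4}`, encoded with `Fin N → Fin 4`
(index `j : Fin N` is residue `j+1`, value `v : Fin 4` is direction `v+1`). -/
abbrev Conformation (N : ℕ) := Fin N → Fin 4

/-- A single fold instruction: an integer `k` with `|k| ≤ N`. -/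
abbrev FoldVal (N : ℕ) := {k : ℤ // |k| ≤ (N : ℤ)}

/-- Folding sequences `F : ℕ → [−N, N] ∩ ℤ`. -/
abbrev FoldSeq (N : ℕ) := ℕ → FoldVal N

/-- The phase space `𝒳` of the 2D HP protein folding process. -/
abbrev PhaseSpace (N : ℕ) := Conformation N × FoldSeq N

/-- Distance between conformations: `d_C(C,C') = Σ_{k=1}^N δ(C_k,C'_k)·2^{N−k}`. -/
noncomputable def dC (N : ℕ) (C C' : Conformation N) : ℝ :=
  ∑ k : Fin N, (if C k = C' k then 0 else 1) * 2 ^ (N - ((k : ℕ) + 1))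

/-- Distance between folding sequences:
`d_F(F,F') = (9/(2N))·Σ_{k=0}^∞ |F(k) − F'(k)|/10^{k+1}`. -/
noncomputable def dF (N : ℕ) (F F' : FoldSeq N) : ℝ :=
  ((9 : ℝ) / (2 * N)) * ∑' k : ℕ, |((F k : ℤ) : ℝ) - ((F' k : ℤ) : ℝ)| / 10 ^ (k + 1)

/-- The distance on the phase space: `d((C,F),(C',F')) = d_C(C,C') + d_F(F,F')`. -/
noncomputable def dX (N : ℕ) (X Y : PhaseSpace N) : ℝ :=
  dC N X.1 Y.1 + dF N X.2 Y.2

/-- The clockwise fold function `f : 1↦4, 2↦3, 3↦1, 4↦2` (0-indexed: `0↦3, 1↦2, 2↦0, 3↦1`). -/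
def foldClockwise : Fin 4 → Fin 4 := ![3, 2, 0, 1]

/-- The anticlockwise fold function `f⁻¹ : 4↦1, 3↦2, 1↦3, 2↦4`
(0-indexed: `0↦2, 1↦3, 2↦1, 3↦0`). -/
def foldAnticlockwise : Fin 4 → Fin 4 := ![2, 3, 1, 0]

/-- `f^{sign(k)}`: the clockwise fold if `k > 0`, the anticlockwise fold if `k < 0`,
the identity if `k = 0`. -/
def foldPow (k : ℤ) : Fin 4 → Fin 4 :=
  if 0 < k then foldClockwise else if k < 0 then foldAnticlockwise else id

/-- The map `f_k`, acting on a conformation by applying `f^{sign(k)}` to every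
coordinate `≥ |k|` (1-based) and keeping the coordinates `< |k|` unchanged. -/
def foldMap (N : ℕ) (k : ℤ) (C : Conformation N) : Conformation N :=
  fun j => if (((j : ℕ) + 1 : ℤ)) < |k| then C j else foldPow k (C j)

/-- The protein folding map `G(C,F) = (f_{i(F)}(C), σ(F))` where `i(F) = F(0)`
and `σ` is the shift. -/
def G (N : ℕ) (X : PhaseSpace N) : PhaseSpace N :=
  (foldMap N (X.2 0).1 X.1, fun n => X.2 (n + 1))

/-- The fold instruction `0` (no fold). -/
def zeroFold (N : ℕ) : FoldVal N := ⟨0, by simp⟩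

/-- `U ⊆ 𝒳` is open for the metric `d`. -/
def IsOpenD (N : ℕ) (U : Set (PhaseSpace N)) : Prop :=
  ∀ x ∈ U, ∃ ε > 0, ∀ y, dX N x y < ε → y ∈ U

/-- Prepend a finite list of folds to a folding sequence. -/
def appSeq {N : ℕ} : List (FoldVal N) → FoldSeq N → FoldSeq N
  | [], F => F
  | a :: L, F => fun n => Nat.casesOn n a (fun m => appSeq L F m)

/-- Apply a list of folds successively. -/
def foldsL {N : ℕ} : List (FoldVal N) → Conformation N → Conformation N
  | [], C => C
  | a :: L, C => foldsL L (foldMap N a.1 C)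

lemma foldsL_append {N : ℕ} (L L' : List (FoldVal N)) (C : Conformation N) :
    foldsL (L ++ L') C = foldsL L' (foldsL L C) := by
  induction L generalizing C with
  | nil => rfl
  | cons a L ih => exact ih _

lemma G_iter {N : ℕ} (L : List (FoldVal N)) (C : Conformation N) (F : FoldSeq N) :
    (G N)^[L.length] (C, appSeq L F) = (foldsL L C, F) := by
  induction L generalizing C with
  | nil => rfl
  | cons a L ih =>
    rw [List.length_cons, Function.iterate_succ_apply]
    exact ih _

lemma exists_prefix {N : ℕ} (n : ℕ) (F : FoldSeq N) :
    ∃ L : List (FoldVal N), L.length = n ∧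
      ∀ L' T, ∀ i < n, appSeq (L ++ L') T i = F i := by
  induction n generalizing F with
  | zero => exact ⟨[], rfl, fun _ _ i hi => absurd hi (Nat.not_lt_zero i)⟩
  | succ n ih =>
    obtain ⟨L, hL, h⟩ := ih (fun n => F (n + 1))
    refine ⟨F 0 :: L, by simp [hL], ?_⟩
    intro L' T i hi
    cases i with
    | zero => rfl
    | succ i => exact h L' T i (by omega)

lemma clockwise_reach (a b : Fin 4) : ∃ r : ℕ, foldClockwise^[r] a = b := by
  have h : ∀ a b : Fin 4, ∃ r : Fin 4, foldClockwise^[(r : ℕ)] a = b := by decide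
  obtain ⟨r, hr⟩ := h a b
  exact ⟨r, hr⟩

lemma foldsL_replicate {N : ℕ} (m : ℕ) (hm : |((m : ℤ) + 1)| ≤ (N : ℤ)) (r : ℕ)
    (C : Conformation N) (j : Fin N) :
    foldsL (List.replicate r ⟨(m : ℤ) + 1, hm⟩) C j =
      if (j : ℕ) < m then C j else foldClockwise^[r] (C j) := by
  induction r generalizing C with
  | zero => simp [foldsL]
  | succ r ih =>
    rw [List.replicate_succ]
    change foldsL _ (foldMap N ((m : ℤ) + 1) C) j = _
    rw [ih]
    have hp : (0 : ℤ) < (m : ℤ) + 1 := by omega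
    have h2 : foldMap N ((m : ℤ) + 1) C j =
        if (j : ℕ) < m then C j else foldClockwise (C j) := by
      simp only [foldMap, foldPow, if_pos hp, abs_of_pos hp]
      by_cases h : (j : ℕ) < m
      · rw [if_pos h, if_pos (by omega)]
      · rw [if_neg h, if_neg (by omega)]
    rw [h2]
    by_cases h : (j : ℕ) < m
    · simp [h]
    · simp [h]

lemma reach {N : ℕ} (C C' : Conformation N) :
    ∃ L : List (FoldVal N), foldsL L C = C' := by
  have key : ∀ m : ℕ, m ≤ N → ∃ L : List (FoldVal N),
      ∀ j : Fin N, (j : ℕ) < m → foldsL L C j = C' j := by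
    intro m
    induction m with
    | zero => exact fun _ => ⟨[], fun j hj => absurd hj (Nat.not_lt_zero _)⟩
    | succ m ih =>
      intro hm
      obtain ⟨L, hL⟩ := ih (by omega)
      obtain ⟨r, hr⟩ := clockwise_reach (foldsL L C ⟨m, hm⟩) (C' ⟨m, hm⟩)
      have hm' : |((m : ℤ) + 1)| ≤ (N : ℤ) := by
        rw [abs_of_pos (by omega)]; omega
      refine ⟨L ++ List.replicate r ⟨(m : ℤ) + 1, hm'⟩, fun j hj => ?_⟩
      rw [foldsL_append, foldsL_replicate]
      by_cases h : (j : ℕ) < m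
      · rw [if_pos h]; exact hL j h
      · have : j = ⟨m, hm⟩ := Fin.ext (by simp; omega)
        rw [if_neg h, this, hr]
  obtain ⟨L, hL⟩ := key N le_rfl
  exact ⟨L, funext fun j => hL j j.2⟩

lemma dF_le {N : ℕ} (hN : 1 ≤ N) (n : ℕ) (F F' : FoldSeq N)
    (h : ∀ i < n, F' i = F i) : dF N F F' ≤ (1 / 10) ^ n := by
  have hN' : (0 : ℝ) < N := by exact_mod_cast hN
  have hb : ∀ k, |((F k : ℤ) : ℝ) - ((F' k : ℤ) : ℝ)| ≤ 2 * N := by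
    intro k
    have h1 : |((F k : ℤ) : ℝ)| ≤ N := by exact_mod_cast (F k).2
    have h2 : |((F' k : ℤ) : ℝ)| ≤ N := by exact_mod_cast (F' k).2
    have := abs_sub ((F k : ℤ) : ℝ) ((F' k : ℤ) : ℝ)
    linarith
  have hle : ∀ k, |((F k : ℤ) : ℝ) - ((F' k : ℤ) : ℝ)| / 10 ^ (k + 1) ≤
      (2 * N / 10) * (1 / 10 : ℝ) ^ k := by
    intro k
    have : (2 * N / 10) * (1 / 10 : ℝ) ^ k = 2 * N / 10 ^ (k + 1) := by
      rw [one_div, inv_pow, pow_succ]; field_simp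
    rw [this]
    gcongr
    exact hb k
  have hg : HasSum (fun k : ℕ => (1 / 10 : ℝ) ^ k) (10 / 9) := by
    convert hasSum_geometric_of_lt_one (r := (1 / 10 : ℝ)) (by norm_num) (by norm_num) using 1
    norm_num
  have hs : Summable (fun k : ℕ => |((F k : ℤ) : ℝ) - ((F' k : ℤ) : ℝ)| / 10 ^ (k + 1)) :=
    Summable.of_nonneg_of_le (fun k => by positivity) hle (hg.summable.mul_left _)
  have hz : ∑ i ∈ Finset.range n,
      |((F i : ℤ) : ℝ) - ((F' i : ℤ) : ℝ)| / 10 ^ (i + 1) = 0 := by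
    apply Finset.sum_eq_zero
    intro i hi
    rw [h i (Finset.mem_range.1 hi)]; simp
  have ht := hs.sum_add_tsum_nat_add n
  rw [hz, zero_add] at ht
  have hg2 := hg.mul_left ((2 * N / 10) * (1 / 10 : ℝ) ^ n)
  have hle2 : ∑' k : ℕ, |((F (k + n) : ℤ) : ℝ) - ((F' (k + n) : ℤ) : ℝ)| / 10 ^ (k + n + 1) ≤
      (2 * N / 10) * (1 / 10 : ℝ) ^ n * (10 / 9) := by
    rw [← hg2.tsum_eq]
    refine Summable.tsum_le_tsum (fun k => ?_) ((summable_nat_add_iff n).2 hs) hg2.summable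
    refine (hle (k + n)).trans (le_of_eq ?_)
    rw [pow_add]; ring
  unfold dF
  rw [← ht]
  calc (9 : ℝ) / (2 * N) * _ ≤ 9 / (2 * N) * ((2 * N / 10) * (1 / 10 : ℝ) ^ n * (10 / 9)) :=
        mul_le_mul_of_nonneg_left hle2 (by positivity)
    _ = (1 / 10) ^ n := by field_simp

/-- the protein folding map `G` is topologically transitive on `(𝒳, d)`:
for all nonempty open `U, V ⊆ 𝒳` there exists `k ≥ 1` with `G^k(U) ∩ V ≠ ∅`. -/
theorem folding_topologically_transitive (N : ℕ) (hN : 1 ≤ N) :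
    ∀ U V : Set (PhaseSpace N), IsOpenD N U → IsOpenD N V →
      U.Nonempty → V.Nonempty →
      ∃ k : ℕ, 1 ≤ k ∧ ((G N)^[k] '' U ∩ V).Nonempty := by
  intro U V hU _ hUn hVn
  obtain ⟨⟨C, F⟩, hx⟩ := hUn
  obtain ⟨⟨C', F'⟩, hy⟩ := hVn
  obtain ⟨ε, hε, hball⟩ := hU _ hx
  obtain ⟨n, hn⟩ := exists_pow_lt_of_lt_one hε (by norm_num : (1 / 10 : ℝ) < 1)
  obtain ⟨L, hLlen, hL⟩ := exists_prefix (n + 1) F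
  obtain ⟨L', hL'⟩ := reach (foldsL L C) C'
  refine ⟨(L ++ L').length, by simp; omega, (C', F'), ⟨(C, appSeq (L ++ L') F'), ?_, ?_⟩, hy⟩
  · apply hball
    have h0 : dC N C C = 0 := by simp [dC]
    have h1 := dF_le hN n F (appSeq (L ++ L') F') (fun i hi => hL L' F' i (by omega))
    change dC N C C + dF N F (appSeq (L ++ L') F') < ε
    linarith
  · rw [G_iter, foldsL_append, hL']
end

section
/- For the function f_2 : {0,1}^3 → {0,1}^3 defined by f_2(x_1,x_2,x_3) = (¬x_1, x_1, x_2), the iteration graph Γ(f_2) is strongly connected; consequently the chaotic-iterations map G̃_{f_2} is chaotic according to Devaney. -/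
open scoped BigOperators

/-- Boolean states of a system with `N` cells: `{0,1}^N`. -/
abbrev BState (N : ℕ) := Fin N → Bool

/-- Strategies: maps `S : ℕ → {1,…,N}` (encoded with `Fin N`). -/
abbrev Strategy (N : ℕ) := ℕ → Fin N

/-- The phase space `𝒳̃` of chaotic iterations: strategies × boolean states. -/
abbrev CISpace (N : ℕ) := Strategy N × BState N

/-- `F_f(k,E)` agrees with `E` on every `j ≠ k` and equals `f(E)_k` at `k`. -/
def Ff {N : ℕ} (f : BState N → BState N) (k : Fin N) (E : BState N) : BState N :=
  fun j => if j = k then f E k else E j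

/-- The chaotic-iterations map `G̃_f(S,E) = (σ(S), F_f(i(S),E))`, where `i(S) = S(0)`
and `σ` is the shift on strategies. -/
def Gf {N : ℕ} (f : BState N → BState N) (X : CISpace N) : CISpace N :=
  (fun n => X.1 (n + 1), Ff f (X.1 0) X.2)

/-- The distance on `𝒳̃`:
`d((S,E),(Ŝ,Ê)) = Σ_{k=1}^N δ(E_k,Ê_k) + (9/N)·Σ_{k=0}^∞ |S(k) − Ŝ(k)|/10^{k+1}`. -/
noncomputable def dCI {N : ℕ} (X Y : CISpace N) : ℝ :=
  (∑ k : Fin N, if X.2 k = Y.2 k then (0 : ℝ) else 1) +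
    ((9 : ℝ) / N) * ∑' k : ℕ, |((X.1 k : ℕ) : ℝ) - ((Y.1 k : ℕ) : ℝ)| / 10 ^ (k + 1)

/-- `U ⊆ 𝒳̃` is open for the metric `d`. -/
def IsOpenCI {N : ℕ} (U : Set (CISpace N)) : Prop :=
  ∀ x ∈ U, ∃ ε > 0, ∀ y, dCI x y < ε → y ∈ U

/-- `N(i,x)`: the state `x` with its `i`-th component negated. -/
def negComp {N : ℕ} (i : Fin N) (x : BState N) : BState N :=
  Function.update x i (!x i)

/-- Arcs of the iteration graph `Γ(f)`: an arc labeled `i` from `x` to `N(i,x)` iff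
`F_f(i,x) = N(i,x)`. -/
def arc {N : ℕ} (f : BState N → BState N) (x y : BState N) : Prop :=
  ∃ i : Fin N, y = negComp i x ∧ Ff f i x = negComp i x

/-- The iteration graph `Γ(f)` is strongly connected: every vertex is reachable
from every vertex by a directed path of arcs. -/
def GammaStronglyConnected {N : ℕ} (f : BState N → BState N) : Prop :=
  ∀ x y : BState N, Relation.ReflTransGen (arc f) x y

/-- `G̃_f` is chaotic according to Devaney on `(𝒳̃, d)`: its periodic points are
dense, and it is topologically transitive. -/
def DevaneyChaoticCI {N : ℕ} (f : BState N → BState N) : Prop :=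
  (∀ X : CISpace N, ∀ ε : ℝ, 0 < ε →
      ∃ X' : CISpace N, (∃ n : ℕ, 1 ≤ n ∧ (Gf f)^[n] X' = X') ∧ dCI X X' < ε) ∧
  (∀ U V : Set (CISpace N), IsOpenCI U → IsOpenCI V → U.Nonempty → V.Nonempty →
      ∃ k : ℕ, 1 ≤ k ∧ ((Gf f)^[k] '' U ∩ V).Nonempty)

/-- The function `f₂(x₁,x₂,x₃) = (¬x₁, x₁, x₂)`. -/
def f₂ : BState 3 → BState 3 := fun x => ![!x 0, x 0, x 1]

/-- State after `n` steps. -/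
def runCI {N : ℕ} (f : BState N → BState N) (S : Strategy N) (E : BState N) : ℕ → BState N
  | 0 => E
  | n + 1 => Ff f (S n) (runCI f S E n)

theorem runCI_congr {N : ℕ} (f : BState N → BState N) (S T : Strategy N) (E : BState N) (n : ℕ)
    (h : ∀ k < n, S k = T k) : runCI f S E n = runCI f T E n := by
  induction n with
  | zero => rfl
  | succ n ih =>
    simp only [runCI]
    rw [ih (fun k hk => h k (by omega)), h n (by omega)]

theorem runCI_add {N : ℕ} (f : BState N → BState N) (S : Strategy N) (E : BState N) (m n : ℕ) :
    runCI f S E (m + n) = runCI f (fun k => S (m + k)) (runCI f S E m) n := by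
  induction n with
  | zero => rfl
  | succ n ih =>
    rw [← Nat.add_assoc]
    simp only [runCI]
    rw [ih]

theorem Gf_iter {N : ℕ} (f : BState N → BState N) (X : CISpace N) (n : ℕ) :
    (Gf f)^[n] X = (fun k => X.1 (k + n), runCI f X.1 X.2 n) := by
  induction n with
  | zero => rfl
  | succ n ih =>
    rw [Function.iterate_succ_apply', ih]
    simp only [Gf, runCI, Nat.zero_add]
    congr 1
    funext k
    rw [show k + 1 + n = k + (n + 1) by omega]

theorem reachCI {N : ℕ} [NeZero N] (f : BState N → BState N) (h : GammaStronglyConnected f)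
    (x y : BState N) : ∃ n S, runCI f S x n = y := by
  induction h x y with
  | refl => exact ⟨0, fun _ => 0, rfl⟩
  | tail _ hbc ih =>
    obtain ⟨n, S, hS⟩ := ih
    obtain ⟨i, rfl, hi⟩ := hbc
    refine ⟨n + 1, fun k => if k < n then S k else i, ?_⟩
    simp only [runCI, lt_irrefl, if_false]
    rw [runCI_congr f _ S x n (fun k hk => by simp [hk]), hS, hi]

theorem dCI_le (S T : Strategy 3) (E : BState 3) (n : ℕ) (h : ∀ k < n, S k = T k) :
    dCI (S, E) (T, E) ≤ (1 / 10 : ℝ) ^ n := by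
  have hb : ∀ k, |((S k : ℕ) : ℝ) - ((T k : ℕ) : ℝ)| ≤ 3 := by
    intro k
    have h1 : ((S k : ℕ) : ℝ) < 3 := by exact_mod_cast (S k).2
    have h2 : ((T k : ℕ) : ℝ) < 3 := by exact_mod_cast (T k).2
    have h3 : (0 : ℝ) ≤ ((S k : ℕ) : ℝ) := Nat.cast_nonneg _
    have h4 : (0 : ℝ) ≤ ((T k : ℕ) : ℝ) := Nat.cast_nonneg _
    rw [abs_le]
    constructor <;> linarith
  have hg : HasSum (fun k : ℕ => (3 / 10 : ℝ) * (1 / 10) ^ k) (1 / 3) := by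
    have := (hasSum_geometric_of_lt_one (r := (1 / 10 : ℝ)) (by norm_num) (by norm_num)).mul_left
      (3 / 10 : ℝ)
    norm_num at this ⊢
    exact this
  have hle : ∀ k, |((S k : ℕ) : ℝ) - ((T k : ℕ) : ℝ)| / 10 ^ (k + 1)
      ≤ (3 / 10 : ℝ) * (1 / 10) ^ k := by
    intro k
    have : (3 / 10 : ℝ) * (1 / 10) ^ k = 3 / 10 ^ (k + 1) := by
      rw [pow_succ, one_div, inv_pow]; field_simp
    rw [this]
    gcongr
    exact hb k
  have hs : Summable (fun k => |((S k : ℕ) : ℝ) - ((T k : ℕ) : ℝ)| / 10 ^ (k + 1)) :=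
    Summable.of_nonneg_of_le (fun k => by positivity) hle hg.summable
  have h0 : ∑ k ∈ Finset.range n, |((S k : ℕ) : ℝ) - ((T k : ℕ) : ℝ)| / 10 ^ (k + 1) = 0 := by
    apply Finset.sum_eq_zero
    intro k hk
    rw [h k (Finset.mem_range.1 hk)]
    simp
  have h1 := hs.sum_add_tsum_nat_add n
  rw [h0, zero_add] at h1
  have h2 : ∑' k : ℕ, |((S (k + n) : ℕ) : ℝ) - ((T (k + n) : ℕ) : ℝ)| / 10 ^ (k + n + 1)
      ≤ (1 / 10 : ℝ) ^ n * (1 / 3) := by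
    rw [← (hg.mul_left ((1 / 10 : ℝ) ^ n)).tsum_eq]
    refine Summable.tsum_le_tsum (fun k => ?_) ((summable_nat_add_iff n).2 hs)
      (hg.mul_left _).summable
    refine (hle (k + n)).trans (le_of_eq ?_)
    rw [pow_add]; ring
  simp only [dCI, if_true, Finset.sum_const_zero, zero_add]
  rw [← h1]
  push_cast
  linarith

theorem devaney_of_connected (f : BState 3 → BState 3) (h : GammaStronglyConnected f) :
    DevaneyChaoticCI f := by
  have hsmall : ∀ ε : ℝ, 0 < ε → ∃ n : ℕ, 1 ≤ n ∧ (1 / 10 : ℝ) ^ n < ε := by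
    intro ε hε
    obtain ⟨n, hn⟩ := exists_pow_lt_of_lt_one hε (show (1 / 10 : ℝ) < 1 by norm_num)
    refine ⟨n + 1, by omega, lt_of_le_of_lt ?_ hn⟩
    exact pow_le_pow_of_le_one (by norm_num) (by norm_num) (by omega)
  constructor
  · rintro ⟨S, E⟩ ε hε
    obtain ⟨n, hn, hlt⟩ := hsmall ε hε
    obtain ⟨m, T, hT⟩ := reachCI f h (runCI f S E n) E
    let S' : Strategy 3 := fun k =>
      if k % (n + m) < n then S (k % (n + m)) else T (k % (n + m) - n)
    have hS : ∀ k < n, S k = S' k := by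
      intro k hk
      have : k % (n + m) = k := Nat.mod_eq_of_lt (by omega)
      simp [S', this, hk]
    refine ⟨(S', E), ⟨n + m, by omega, ?_⟩, lt_of_le_of_lt (dCI_le S S' E n hS) hlt⟩
    rw [Gf_iter]
    congr 1
    · funext k
      simp [S']
    · simp only
      rw [runCI_add, ← runCI_congr f S S' E n hS]
      rw [runCI_congr f _ T _ m, hT]
      intro k hk
      have : (n + k) % (n + m) = n + k := Nat.mod_eq_of_lt (by omega)
      simp [S', this]
  · rintro U V hU - ⟨⟨S, E⟩, hx⟩ ⟨⟨S₂, E₂⟩, hy⟩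
    obtain ⟨ε, hε, hball⟩ := hU _ hx
    obtain ⟨n, hn, hlt⟩ := hsmall ε hε
    obtain ⟨m, T, hT⟩ := reachCI f h (runCI f S E n) E₂
    let S' : Strategy 3 := fun k =>
      if k < n then S k else if k < n + m then T (k - n) else S₂ (k - (n + m))
    have hS : ∀ k < n, S k = S' k := by
      intro k hk
      simp [S', hk]
    refine ⟨n + m, by omega, (S₂, E₂), ⟨(S', E), hball _ (lt_of_le_of_lt (dCI_le S S' E n hS) hlt),
      ?_⟩, hy⟩
    rw [Gf_iter]
    congr 1
    · funext k
      have h1 : ¬ (k + (n + m) < n) := by omega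
      have h2 : ¬ (k + (n + m) < n + m) := by omega
      simp only [S', h1, h2, if_false, Nat.add_sub_cancel]
    · simp only
      rw [runCI_add, ← runCI_congr f S S' E n hS]
      rw [runCI_congr f _ T _ m, hT]
      intro k hk
      simp [S', hk]

theorem f₂_step (i : Fin 3) (x : BState 3) : Relation.ReflTransGen (arc f₂) x (Ff f₂ i x) := by
  by_cases hx : f₂ x i = x i
  · have : Ff f₂ i x = x := by
      funext j
      by_cases hj : j = i
      · subst hj; simp [Ff, hx]
      · simp [Ff, hj]
    rw [this]
  · have : Ff f₂ i x = negComp i x := by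
      funext j
      by_cases hj : j = i
      · subst hj
        simp only [Ff, negComp, if_true, Function.update_self]
        revert hx
        cases f₂ x j <;> cases x j <;> simp
      · simp [Ff, negComp, hj]
    exact Relation.ReflTransGen.single ⟨i, this, this⟩

theorem f₂_set0 (b : Bool) (x : BState 3) :
    Relation.ReflTransGen (arc f₂) x ![b, x 1, x 2] := by
  by_cases hx : x 0 = b
  · have : ![b, x 1, x 2] = x := by
      funext j; fin_cases j <;> simp [hx]
    rw [this]
  · have : ![b, x 1, x 2] = Ff f₂ 0 x := by
      funext j
      fin_cases j
      · revert hx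
        cases h : x 0 <;> cases b <;> simp [Ff, f₂, h]
      · simp [Ff]
      · simp [Ff]
    rw [this]
    exact f₂_step 0 x

theorem f₂_set1 (x : BState 3) : Relation.ReflTransGen (arc f₂) x ![x 0, x 0, x 2] := by
  have : ![x 0, x 0, x 2] = Ff f₂ 1 x := by
    funext j; fin_cases j <;> simp [Ff, f₂]
  rw [this]
  exact f₂_step 1 x

theorem f₂_set2 (x : BState 3) : Relation.ReflTransGen (arc f₂) x ![x 0, x 1, x 1] := by
  have : ![x 0, x 1, x 1] = Ff f₂ 2 x := by
    funext j; fin_cases j <;> simp [Ff, f₂]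
  rw [this]
  exact f₂_step 2 x

theorem f₂_connected : GammaStronglyConnected f₂ := by
  intro x y
  have h1 := f₂_set0 (y 2) x
  have h2 := h1.trans (f₂_set1 _)
  have h3 := h2.trans (f₂_set2 _)
  have h4 := h3.trans (f₂_set0 (y 1) _)
  have h5 := h4.trans (f₂_set1 _)
  have h6 := h5.trans (f₂_set0 (y 0) _)
  convert h6 using 1
  funext j; fin_cases j <;> rfl

/-- `Γ(f₂)` is strongly connected; consequently `G̃_{f₂}` is chaotic
according to Devaney. -/
theorem f₂_strongly_connected_and_chaotic :
    GammaStronglyConnected f₂ ∧ DevaneyChaoticCI f₂ := 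
  ⟨f₂_connected, devaney_of_connected f₂ f₂_connected⟩
end
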